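/- Let n ≥ 1, let G be a subgroup of Sym(n), let C ⊆ G be a clique and S ⊆ G an independent set in the derangement graph Γ_G with |C|·|S| = |G|. If χ is an irreducible complex character of G other than the trivial character and Σ_{c ∈ C} χ(c) ≠ 0, then E_χ v_S = 0, where v_S ∈ {0,1}^G is the characteristic vector of S and E_χ is the |G|×|G| complex matrix with (π,σ)-entry (χ(1)/|G|)·χ(π^{-1}σ). -/

import Mathlib

open Matrix
open CategoryTheory

/-- **Schur's lemma**: an endomorphism of a simple complex representation commuting with the
action is a scalar. -/
theorem FDRep.exists_eq_smul_id_of_comm {G : Type*} [Group G] (V : FDRep ℂ G) [Simple V]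
    (f : V →ₗ[ℂ] V) (hf : ∀ g, V.ρ g ∘ₗ f = f ∘ₗ V.ρ g) :
    ∃ μ : ℂ, f = μ • LinearMap.id := by
  have hmem : ∀ e : V →ₗ[ℂ] V, (∀ g, V.ρ g ∘ₗ e = e ∘ₗ V.ρ g) →
      e ∈ (Representation.linHom V.ρ V.ρ).invariants := fun e he g => by
    rw [Representation.linHom_apply, ← LinearMap.comp_assoc, he, LinearMap.comp_assoc,
      ← Module.End.mul_eq_comp (V.ρ g), ← map_mul, mul_inv_cancel, map_one]
    rfl
  have h1 : Module.finrank ℂ (Representation.linHom V.ρ V.ρ).invariants = 1 := by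
    rw [(Representation.linHom.invariantsEquivFDRepHom V V).finrank_eq]
    exact finrank_endomorphism_simple_eq_one ℂ V
  cases subsingleton_or_nontrivial V with
  | inl _ => exact ⟨0, LinearMap.ext fun v => Subsingleton.elim _ _⟩
  | inr _ =>
    have hid : (⟨LinearMap.id, hmem LinearMap.id fun g => rfl⟩ :
        (Representation.linHom V.ρ V.ρ).invariants) ≠ 0 := fun h =>
      one_ne_zero (α := Module.End ℂ V) (congrArg Subtype.val h)
    obtain ⟨μ, hμ⟩ := (finrank_eq_one_iff_of_nonzero' _ hid).1 h1 ⟨f, hmem f hf⟩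
    exact ⟨μ, (congrArg Subtype.val hμ).symm⟩

/-- The sum of all group elements acts as zero on a nontrivial irreducible representation. -/
theorem FDRep.sum_ρ_eq_zero {G : Type*} [Group G] [Fintype G] (V : FDRep ℂ G) [Simple V]
    (hV : V.character ≠ fun _ => 1) : ∑ g, V.ρ g = 0 := by
  have hmul : ∀ h, V.ρ h * ∑ g, V.ρ g = ∑ g, V.ρ g := fun h => by
    simp_rw [Finset.mul_sum, ← map_mul]
    exact (Group.mulLeft_bijective h).sum_comp V.ρ
  have hmul' : ∀ h, (∑ g, V.ρ g) * V.ρ h = ∑ g, V.ρ g := fun h => by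
    simp_rw [Finset.sum_mul, ← map_mul]
    exact (Group.mulRight_bijective h).sum_comp V.ρ
  obtain ⟨μ, hμ⟩ := V.exists_eq_smul_id_of_comm (∑ g, V.ρ g) fun h => (hmul h).trans (hmul' h).symm
  by_contra hne
  have hμ0 : μ ≠ 0 := by
    rintro rfl
    exact hne (by simpa using hμ)
  have hρ : ∀ h, V.ρ h = 1 := fun h => by
    have := hmul h
    rw [hμ] at this
    ext v
    have := LinearMap.congr_fun this v
    simpa [hμ0] using this
  apply hV
  have hscalar : ∀ f : V →ₗ[ℂ] V, ∃ μ : ℂ, μ • LinearMap.id = f := fun f =>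
    (V.exists_eq_smul_id_of_comm f fun g => by rw [hρ]; rfl).imp fun _ => Eq.symm
  have hle : Module.finrank ℂ (V →ₗ[ℂ] V) ≤ 1 := finrank_le_one _ hscalar
  rw [Module.finrank_linearMap] at hle
  have hpos : Module.finrank ℂ V ≠ 0 := fun h0 => by
    have := Module.finrank_zero_iff.1 h0
    exact hne (LinearMap.ext fun v => Subsingleton.elim _ _)
  have h1 : Module.finrank ℂ V = 1 := by nlinarith [Nat.pos_of_ne_zero hpos]
  funext g
  rw [FDRep.character, hρ, LinearMap.trace_one, h1, Nat.cast_one]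

open scoped ComplexOrder in
/-- Every complex representation of a finite group preserves a positive definite Hermitian form,
so its character at `g⁻¹` is the complex conjugate of its character at `g`. -/
theorem FDRep.char_inv_eq_star {G : Type*} [Group G] [Finite G] (V : FDRep ℂ G) (g : G) :
    V.character g⁻¹ = star (V.character g) := by
  have := Fintype.ofFinite G
  let b := Module.finBasis ℂ V
  let M : G → Matrix _ _ ℂ := fun g => LinearMap.toMatrix b b (V.ρ g)
  have hM : ∀ g h, M (g * h) = M g * M h := fun g h => by
    simp only [M, map_mul, LinearMap.toMatrix_mul]
  have hM1 : M 1 = 1 := by simp [M]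
  have htr : ∀ g, V.character g = (M g).trace := fun g =>
    LinearMap.trace_eq_matrix_trace ℂ b (V.ρ g)
  classical
  let H := ∑ g, (M g)ᴴ * M g
  have hH : H.PosDef := by
    rw [show H = (M 1)ᴴ * M 1 + ∑ g ∈ Finset.univ.erase 1, (M g)ᴴ * M g from
      (Finset.add_sum_erase _ _ (Finset.mem_univ _)).symm]
    refine Matrix.PosDef.add_posSemidef (by rw [hM1]; simpa using Matrix.PosDef.one) ?_
    exact Matrix.posSemidef_sum _ fun g _ => Matrix.posSemidef_conjTranspose_mul_self _
  have hinv : (M g)ᴴ * H * M g = H := by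
    simp only [H, Finset.mul_sum, Finset.sum_mul]
    rw [← (Group.mulRight_bijective g).sum_comp fun g => (M g)ᴴ * M g]
    refine Finset.sum_congr rfl fun h _ => ?_
    simp only [hM, Matrix.conjTranspose_mul, Matrix.mul_assoc]
  have hdet : IsUnit H.det := (Matrix.isUnit_iff_isUnit_det _).1 hH.isUnit
  have hcomm : (M g)ᴴ * H = H * M g⁻¹ := by
    conv_rhs => rw [← hinv]
    rw [Matrix.mul_assoc, ← hM, mul_inv_cancel, hM1, Matrix.mul_one]
  rw [htr, htr, ← Matrix.trace_conjTranspose]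
  rw [← Matrix.mul_nonsing_inv_cancel_right _ (M g)ᴴ hdet, hcomm, Matrix.trace_mul_comm,
    Matrix.nonsing_inv_mul_cancel_left _ _ hdet]

/-- If every conjugate of `C` tiles `G` together with `S`, then `∑ s ∈ S, ρ s = 0` for any
nontrivial irreducible `ρ` whose character has nonzero sum over `C`. -/
theorem FDRep.sum_ρ_eq_zero_of_tiling {G : Type*} [Group G] [Fintype G] (V : FDRep ℂ G) [Simple V]
    (hV : V.character ≠ fun _ => 1) (C S : Finset G)
    (htile : ∀ g, Function.Bijective fun p : C × S => g * (p.1 : G)⁻¹ * g⁻¹ * p.2)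
    (hsum : ∑ c ∈ C, V.character c ≠ 0) : ∑ s ∈ S, V.ρ s = 0 := by
  let Z := ∑ g, ∑ c ∈ C, V.ρ (g * c⁻¹ * g⁻¹)
  have hZS : Z * ∑ s ∈ S, V.ρ s = 0 := by
    rw [Finset.sum_mul]
    refine Finset.sum_eq_zero fun g _ => ?_
    rw [← V.sum_ρ_eq_zero hV, ← (htile g).sum_comp V.ρ, Fintype.sum_prod_type, Finset.sum_mul_sum,
      ← Finset.sum_coe_sort C]
    refine Finset.sum_congr rfl fun c _ => ?_
    rw [← Finset.sum_coe_sort S]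
    simp only [map_mul]
  have hcomm : ∀ h, V.ρ h * Z = Z * V.ρ h := fun h => by
    simp only [Z, Finset.mul_sum, Finset.sum_mul, ← map_mul]
    conv_rhs => rw [← (Group.mulLeft_bijective h).sum_comp]
    refine Finset.sum_congr rfl fun g _ => Finset.sum_congr rfl fun c _ => congrArg _ ?_
    group
  obtain ⟨μ, hμ⟩ := V.exists_eq_smul_id_of_comm Z hcomm
  have htrZ : LinearMap.trace ℂ V Z = Fintype.card G * star (∑ c ∈ C, V.character c) := by
    have : ∀ g c, LinearMap.trace ℂ V (V.ρ (g * c⁻¹ * g⁻¹)) = star (V.character c) := fun g c => by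
      rw [← V.char_inv_eq_star, ← V.char_conj c⁻¹ g]; rfl
    simp only [Z, map_sum, this, star_sum, Finset.sum_const, Finset.card_univ, nsmul_eq_mul]
  have hμ0 : μ ≠ 0 := by
    rintro rfl
    rw [hμ, zero_smul, map_zero] at htrZ
    exact mul_ne_zero (Nat.cast_ne_zero.2 Fintype.card_ne_zero) (star_ne_zero.2 hsum) htrZ.symm
  rw [hμ] at hZS
  ext v
  have := LinearMap.congr_fun hZS v
  simpa [hμ0] using this



/-- If the clique–coclique bound holds with equality in the derangement graph of
`G ≤ Sym(n)`, `χ` is a nontrivial irreducible complex character of `G`, and some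
maximum clique `C` has `Σ_{c ∈ C} χ(c) ≠ 0`, then `E_χ v_S = 0` for the maximum
independent set `S`. -/
theorem clique_nonzero_character_sum_kills_module {n : ℕ} (hn : 1 ≤ n)
    (G : Subgroup (Equiv.Perm (Fin n))) [Fintype G] [DecidableEq G]
    (C S : Finset G)
    (hC : ∀ π ∈ C, ∀ σ ∈ C, π ≠ σ →
      ∀ x : Fin n, ((π * σ⁻¹ : G) : Equiv.Perm (Fin n)) x ≠ x)
    (hS : ∀ π ∈ S, ∀ σ ∈ S,
      ∃ x : Fin n, ((π * σ⁻¹ : G) : Equiv.Perm (Fin n)) x = x)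
    (hcard : C.card * S.card = Fintype.card G)
    (V : FDRep ℂ G) (hsimple : CategoryTheory.Simple V)
    (htriv : V.character ≠ fun _ => 1)
    (hsum : ∑ c ∈ C, V.character c ≠ 0) :
    let E : Matrix G G ℂ :=
      fun π σ => (V.character 1 / (Fintype.card G : ℂ)) * V.character (π⁻¹ * σ)
    let vS : G → ℂ := fun g => if g ∈ S then 1 else 0
    E.mulVec vS = 0 := by
  intro E vS
  have htile : ∀ g, Function.Bijective fun p : C × S => g * (p.1 : G)⁻¹ * g⁻¹ * p.2 := by
    intro g
    rw [Fintype.bijective_iff_injective_and_card]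
    refine ⟨?_, by simpa using hcard⟩
    rintro ⟨⟨c, hc⟩, ⟨s, hs⟩⟩ ⟨⟨c', hc'⟩, ⟨s', hs'⟩⟩ h
    dsimp only at h
    have hconj : c' * c⁻¹ = g⁻¹ * (s' * s⁻¹) * g := by
      calc c' * c⁻¹ = c' * g⁻¹ * (g * c⁻¹ * g⁻¹ * s) * s⁻¹ * g := by group
        _ = g⁻¹ * (s' * s⁻¹) * g := by rw [h]; group
    have hcc : c = c' := by
      by_contra hne
      obtain ⟨x, hx⟩ := hS s' hs' s hs
      refine hC c' hc' c hc (Ne.symm hne) ((g⁻¹ : G).1 x) ?_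
      rw [hconj]
      simpa using hx
    subst hcc
    simp_all
  have hρ := V.sum_ρ_eq_zero_of_tiling htriv C S htile hsum
  funext π
  have hπ : ∑ s ∈ S, V.character (π⁻¹ * s) = 0 := by
    simp only [FDRep.character, map_mul, ← map_sum, ← Finset.mul_sum, hρ, mul_zero, map_zero]
  simp [E, vS, Matrix.mulVec, dotProduct, ← Finset.mul_sum, hπ]
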